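/- Let f, g, h be locally integrable complex-valued functions on ℝ, let P denote the primitive operator Pu(x) = ∫_0^x u, and set F = −e^{Pg} f and H = e^{−Pg} h. Define the 2×2 matrix function M(x) with entries M_{11} = e^{(1/2)Pg} C_{F,H}, M_{12} = e^{(1/2)Pg} S_{H,F}, M_{21} = e^{−(1/2)Pg} S_{F,H}, M_{22} = e^{−(1/2)Pg} C_{H,F}. Then each entry of M is locally absolutely continuous, M(0) = I, det M(x) = 1 for all x ∈ ℝ, and almost everywhere M′ = m M where m is the matrix with rows ((1/2)g, h) and (−f, −(1/2)g). -/

import Mathlib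

open MeasureTheory intervalIntegral Filter

noncomputable section

/-- Alternating product f(s1)g(s2)f(s3)⋯ with j factors (index 0 ↦ f). -/
def altProd (f g : ℝ → ℂ) (j : ℕ) (s : Fin j → ℝ) : ℂ :=
  ∏ i : Fin j, if (i : ℕ) % 2 = 0 then f (s i) else g (s i)

/-- The signed simplex integral A_j(f,g,x). -/
def simplexA (f g : ℝ → ℂ) (j : ℕ) (x : ℝ) : ℂ :=
  if 0 ≤ x then
    ∫ s in {s : Fin j → ℝ | StrictMono s ∧ ∀ i, s i ∈ Set.Ioo 0 x}, altProd f g j s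
  else
    (-1 : ℂ) ^ j *
      ∫ s in {s : Fin j → ℝ | StrictAnti s ∧ ∀ i, s i ∈ Set.Ioo x 0}, altProd f g j s

/-- The bivariate exponential E_{f,g}. -/
def bivE (f g : ℝ → ℂ) (x : ℝ) : ℂ := 1 + ∑' j : ℕ, simplexA f g (j + 1) x

def bivC (f g : ℝ → ℂ) (x : ℝ) : ℂ := (bivE f g x + bivE (-f) (-g) x) / 2

def bivS (f g : ℝ → ℂ) (x : ℝ) : ℂ := (bivE f g x - bivE (-f) (-g) x) / 2

/-- Locally absolutely continuous complex-valued function on ℝ. -/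
def LocAC (F : ℝ → ℂ) : Prop :=
  ∃ F' : ℝ → ℂ, LocallyIntegrable F' volume ∧
    ∀ x : ℝ, F x = F 0 + ∫ t in (0:ℝ)..x, F' t

end

theorem MeasureTheory.LocallyIntegrable.intervalIntegrable_uIoc {E : Type*} [NormedAddCommGroup E]
    {f : ℝ → E} (hf : LocallyIntegrable f volume) (a b : ℝ) :
    IntervalIntegrable f volume a b :=
  intervalIntegrable_iff.mpr <|
    (hf.integrableOn_isCompact isCompact_uIcc).mono_set Set.uIoc_subset_uIcc

theorem AbsolutelyContinuousOnInterval.of_dist_le {X Y : Type*} [PseudoMetricSpace X]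
    [PseudoMetricSpace Y] {F : ℝ → X} {G : ℝ → Y} {a b : ℝ} (K : ℝ)
    (hG : AbsolutelyContinuousOnInterval G a b)
    (h : ∀ x ∈ Set.uIcc a b, ∀ y ∈ Set.uIcc a b, dist (F x) (F y) ≤ K * dist (G x) (G y)) :
    AbsolutelyContinuousOnInterval F a b := by
  unfold AbsolutelyContinuousOnInterval at hG ⊢
  refine squeeze_zero' (.of_forall fun E ↦ Finset.sum_nonneg fun i _ ↦ dist_nonneg) ?_
    (by simpa using Filter.Tendsto.const_mul K hG)
  rw [eventually_inf_principal]
  refine .of_forall fun E hE ↦ ?_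
  rw [Finset.mul_sum]
  exact Finset.sum_le_sum fun i hi ↦ h _ (hE.1 i hi).1 _ (hE.1 i hi).2

theorem MeasureTheory.LocallyIntegrable.absolutelyContinuousOnInterval_integral {E : Type*}
    [NormedAddCommGroup E] [NormedSpace ℝ E] {f : ℝ → E} (hf : LocallyIntegrable f volume)
    (a b : ℝ) : AbsolutelyContinuousOnInterval (fun x ↦ ∫ t in (0:ℝ)..x, f t) a b := by
  refine .of_dist_le 1 ((hf.intervalIntegrable_uIoc a b).norm
    |>.absolutelyContinuousOnInterval_intervalIntegral Set.left_mem_uIcc) fun x _ y _ ↦ ?_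
  have hn : ∀ u v, IntervalIntegrable (fun t ↦ ‖f t‖) volume u v :=
    fun u v ↦ (hf.intervalIntegrable_uIoc u v).norm
  rw [dist_eq_norm, dist_eq_norm, one_mul,
    integral_interval_sub_left (hf.intervalIntegrable_uIoc _ _) (hf.intervalIntegrable_uIoc _ _),
    integral_interval_sub_left (hn _ _) (hn _ _)]
  exact norm_integral_le_abs_integral_norm

/-- `F` is the integral of the locally integrable function `F'`, up to a constant. -/
def IsLocPrimitive {E : Type*} [NormedAddCommGroup E] [NormedSpace ℝ E] (F F' : ℝ → E) : Prop :=
  LocallyIntegrable F' volume ∧ ∀ x : ℝ, F x = F 0 + ∫ t in (0:ℝ)..x, F' t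

namespace IsLocPrimitive

section Banach

variable {E : Type*} [NormedAddCommGroup E] [NormedSpace ℝ E] {F F' : ℝ → E}

theorem integral {f : ℝ → E} (hf : LocallyIntegrable f volume) :
    IsLocPrimitive (fun x ↦ ∫ t in (0:ℝ)..x, f t) f :=
  ⟨hf, fun x ↦ by simp⟩

theorem absolutelyContinuous (h : IsLocPrimitive F F') (a b : ℝ) :
    AbsolutelyContinuousOnInterval F a b := by
  refine .of_dist_le 1 (h.1.absolutelyContinuousOnInterval_integral a b) fun x _ y _ ↦ ?_
  rw [h.2 x, h.2 y, dist_add_left, one_mul]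

theorem continuous (h : IsLocPrimitive F F') : Continuous F := by
  rw [funext h.2]
  exact continuous_const.add (continuous_primitive h.1.intervalIntegrable_uIoc 0)

variable [CompleteSpace E]

theorem ae_hasDerivAt (h : IsLocPrimitive F F') : ∀ᵐ x, HasDerivAt F (F' x) x := by
  filter_upwards [_root_.LocallyIntegrable.ae_hasDerivAt_integral h.1] with x hx
  rw [funext h.2]
  exact (hx 0).const_add _

theorem of_absolutelyContinuous (hF : ∀ a b, AbsolutelyContinuousOnInterval F a b)
    (hF' : LocallyIntegrable F' volume) (h : ∀ᵐ x, HasDerivAt F (F' x) x) :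
    IsLocPrimitive F F' := by
  refine ⟨hF', fun x ↦ ?_⟩
  have hac := (hF 0 x).sub (hF'.absolutelyContinuousOnInterval_integral 0 x)
  obtain ⟨C, hC⟩ := hac.const_of_ae_hasDerivAt_zero (by
    filter_upwards [h, _root_.LocallyIntegrable.ae_hasDerivAt_integral hF'] with y h₁ h₂ _
    simpa using h₁.sub (h₂ 0))
  have h₀ := hC 0 Set.left_mem_uIcc
  have h₁ := hC x Set.right_mem_uIcc
  simp only [Pi.sub_apply, integral_same, sub_zero] at h₀ h₁
  rw [h₀, ← h₁]
  abel

end Banach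

theorem mul {𝕜 : Type*} [RCLike 𝕜] {F F' G G' : ℝ → 𝕜} (hF : IsLocPrimitive F F')
    (hG : IsLocPrimitive G G') :
    IsLocPrimitive (fun x ↦ F x * G x) (fun x ↦ F' x * G x + F x * G' x) := by
  refine of_absolutelyContinuous
    (fun a b ↦ (hF.absolutelyContinuous a b).smul (hG.absolutelyContinuous a b))
    ((hF.1.mul_continuous hG.continuous).add ?_) ?_
  · simpa only [mul_comm] using hG.1.mul_continuous hF.continuous
  · filter_upwards [hF.ae_hasDerivAt, hG.ae_hasDerivAt] with x h₁ h₂ using h₁.mul h₂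

theorem pow {𝕜 : Type*} [RCLike 𝕜] {F F' : ℝ → 𝕜} (hF : IsLocPrimitive F F') (n : ℕ) :
    IsLocPrimitive (fun x ↦ F x ^ (n + 1)) (fun x ↦ (n + 1) * (F' x * F x ^ n)) := by
  induction n with
  | zero => simpa using hF
  | succ n ih =>
    convert! ih.mul hF using 2 with x
    · ring
    · rw [Nat.cast_add_one]
      ring

theorem const_mul {𝕜 : Type*} [RCLike 𝕜] {F F' : ℝ → 𝕜} (c : 𝕜) (hF : IsLocPrimitive F F') :
    IsLocPrimitive (fun x ↦ c * F x) (fun x ↦ c * F' x) := by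
  refine ⟨hF.1.smul c, fun x ↦ ?_⟩
  simp only
  rw [hF.2 x, intervalIntegral.integral_const_mul, mul_add]

theorem cexp {F F' : ℝ → ℂ} (hF : IsLocPrimitive F F') :
    IsLocPrimitive (fun x ↦ Complex.exp (F x)) (fun x ↦ F' x * Complex.exp (F x)) := by
  refine of_absolutelyContinuous (fun a b ↦ ?_)
    (hF.1.mul_continuous (Complex.continuous_exp.comp hF.continuous)) ?_
  · obtain ⟨R, hR⟩ := (hF.absolutelyContinuous a b).exists_bound
    obtain ⟨K, hK⟩ := (Complex.contDiff_exp (𝕜 := ℝ) (n := 1)).contDiffOn.exists_lipschitzOnWith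
      one_ne_zero (convex_closedBall (0 : ℂ) R) (isCompact_closedBall _ _)
    exact .of_dist_le K (hF.absolutelyContinuous a b) fun x hx y hy ↦
      hK.dist_le_mul _ (by simpa using hR x hx) _ (by simpa using hR y hy)
  · filter_upwards [hF.ae_hasDerivAt] with x hx
    simpa only [mul_comm] using hx.cexp

end IsLocPrimitive

theorem simplexA_zero (f g : ℝ → ℂ) (x : ℝ) : simplexA f g 0 x = 1 := by
  have h₁ : {s : Fin 0 → ℝ | StrictMono s ∧ ∀ i, s i ∈ Set.Ioo 0 x} = Set.univ :=
    Set.eq_univ_of_forall fun s ↦ ⟨fun i ↦ i.elim0, fun i ↦ i.elim0⟩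
  have h₂ : {s : Fin 0 → ℝ | StrictAnti s ∧ ∀ i, s i ∈ Set.Ioo x 0} = Set.univ :=
    Set.eq_univ_of_forall fun s ↦ ⟨fun i ↦ i.elim0, fun i ↦ i.elim0⟩
  rw [simplexA, h₁, h₂, Measure.volume_pi_eq_dirac]
  simp [altProd]

theorem simplexA_neg_neg (f g : ℝ → ℂ) (j : ℕ) (x : ℝ) :
    simplexA (-f) (-g) j x = (-1) ^ j * simplexA f g j x := by
  have h : ∀ s, altProd (-f) (-g) j s = (-1) ^ j * altProd f g j s := fun s ↦ by
    simp only [altProd, Pi.neg_apply, ← neg_ite, Finset.prod_neg]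
    simp
  simp only [simplexA, h, MeasureTheory.integral_const_mul]
  split_ifs
  · rfl
  · rfl

theorem altProd_snoc (f g : ℝ → ℂ) (n : ℕ) (s : Fin n → ℝ) (t : ℝ) :
    altProd f g (n + 1) (Fin.snoc s t : Fin (n + 1) → ℝ) =
      (if n % 2 = 0 then f t else g t) * altProd f g n s := by
  simp [altProd, Fin.prod_univ_castSucc, mul_comm]

theorem integrableOn_altProd_pi {f g : ℝ → ℂ} (hf : LocallyIntegrable f volume)
    (hg : LocallyIntegrable g volume) (n : ℕ) (u v : ℝ) :
    IntegrableOn (altProd f g n) (Set.univ.pi fun _ ↦ Set.Ioo u v) := by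
  have : ∀ φ : ℝ → ℂ, LocallyIntegrable φ volume → IntegrableOn φ (Set.Ioo u v) := fun φ h ↦
    (h.integrableOn_isCompact isCompact_Icc).mono_set Set.Ioo_subset_Icc_self
  rw [IntegrableOn, volume_pi, Measure.restrict_pi_pi]
  refine Integrable.fintype_prod
    (f := fun (i : Fin n) t ↦ if (i : ℕ) % 2 = 0 then f t else g t) fun i ↦ ?_
  split_ifs
  exacts [this f hf, this g hg]

theorem setIntegral_altProd_succ (f g : ℝ → ℂ) {n : ℕ} {D : Set (Fin (n + 1) → ℝ)} {I : Set ℝ}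
    {D' : ℝ → Set (Fin n → ℝ)} (hD : MeasurableSet D) (hI : MeasurableSet I)
    (hD' : ∀ t, MeasurableSet (D' t))
    (h : ∀ (s : Fin n → ℝ) (t : ℝ), (Fin.snoc s t : Fin (n + 1) → ℝ) ∈ D ↔ t ∈ I ∧ s ∈ D' t)
    (hInt : IntegrableOn (altProd f g (n + 1)) D) :
    ∫ s in D, altProd f g (n + 1) s =
      ∫ t in I, (if n % 2 = 0 then f t else g t) * ∫ s in D' t, altProd f g n s := by
  have hmp := (volume_preserving_piFinSuccAbove (fun _ : Fin (n + 1) ↦ ℝ) (Fin.last n)).symm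
  have hemb := (MeasurableEquiv.piFinSuccAbove (fun _ : Fin (n + 1) ↦ ℝ)
    (Fin.last n)).symm.measurableEmbedding
  have hsymm : ∀ p : ℝ × (Fin n → ℝ), (MeasurableEquiv.piFinSuccAbove
      (fun _ : Fin (n + 1) ↦ ℝ) (Fin.last n)).symm p = (Fin.snoc p.2 p.1 : Fin (n + 1) → ℝ) :=
    fun p ↦ Fin.insertNth_last' p.1 p.2
  have hInt' := (hmp.integrable_comp_emb hemb).mpr (hInt.integrable_indicator hD)
  rw [← MeasureTheory.integral_indicator hD, ← hmp.integral_comp hemb, Measure.volume_eq_prod,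
    integral_prod (fun p ↦ D.indicator (altProd f g (n + 1)) _) hInt',
    ← MeasureTheory.integral_indicator hI]
  refine integral_congr_ae (.of_forall fun t ↦ ?_)
  simp only [hsymm]
  by_cases ht : t ∈ I
  · rw [Set.indicator_of_mem ht, ← MeasureTheory.integral_const_mul,
      ← MeasureTheory.integral_indicator (hD' t)]
    refine integral_congr_ae (.of_forall fun s ↦ ?_)
    have hst : (Fin.snoc s t : Fin (n + 1) → ℝ) ∈ D ↔ s ∈ D' t := (h s t).trans (and_iff_right ht)
    by_cases hs : s ∈ D' t
    · exact (Set.indicator_of_mem (hst.mpr hs) _).trans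
        ((altProd_snoc f g n s t).trans (Set.indicator_of_mem hs
          (fun s ↦ (if n % 2 = 0 then f t else g t) * altProd f g n s)).symm)
    · exact (Set.indicator_of_notMem (mt hst.mp hs) _).trans (Set.indicator_of_notMem hs _).symm
  · rw [Set.indicator_of_notMem ht]
    simp [Set.indicator, h, ht]

theorem measurableSet_strictMono (n : ℕ) (u v : ℝ) :
    MeasurableSet {s : Fin n → ℝ | StrictMono s ∧ ∀ i, s i ∈ Set.Ioo u v} := by
  simp only [StrictMono, Set.mem_Ioo]
  measurability

theorem measurableSet_strictAnti (n : ℕ) (u v : ℝ) :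
    MeasurableSet {s : Fin n → ℝ | StrictAnti s ∧ ∀ i, s i ∈ Set.Ioo u v} := by
  simp only [StrictAnti, Set.mem_Ioo]
  measurability

theorem snoc_strictMono_Ioo_iff {n : ℕ} (s : Fin n → ℝ) (t u v : ℝ) :
    (StrictMono (Fin.snoc s t : Fin (n + 1) → ℝ) ∧
      ∀ i, (Fin.snoc s t : Fin (n + 1) → ℝ) i ∈ Set.Ioo u v) ↔
      t ∈ Set.Ioo u v ∧ StrictMono s ∧ ∀ i, s i ∈ Set.Ioo u t := by
  constructor
  · rintro ⟨h₁, h₂⟩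
    refine ⟨by simpa using h₂ (Fin.last n), fun i j hij ↦ ?_, fun i ↦ ⟨?_, ?_⟩⟩
    · simpa using h₁ (Fin.castSucc_lt_castSucc_iff.mpr hij)
    · simpa using (h₂ i.castSucc).1
    · simpa using h₁ (Fin.castSucc_lt_last i)
  · rintro ⟨ht, h₁, h₂⟩
    refine ⟨fun i j hij ↦ ?_, fun i ↦ ?_⟩
    · induction j using Fin.lastCases with
      | last =>
        induction i using Fin.lastCases with
        | last => exact absurd hij (lt_irrefl _)
        | cast i => simpa using (h₂ i).2
      | cast j =>
        induction i using Fin.lastCases with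
        | last => exact absurd hij (Fin.castSucc_lt_last j).not_gt
        | cast i => simpa using h₁ (Fin.castSucc_lt_castSucc_iff.mp hij)
    · induction i using Fin.lastCases with
      | last => simpa using ht
      | cast i => simpa using ⟨(h₂ i).1, (h₂ i).2.trans ht.2⟩

theorem snoc_strictAnti_Ioo_iff {n : ℕ} (s : Fin n → ℝ) (t u v : ℝ) :
    (StrictAnti (Fin.snoc s t : Fin (n + 1) → ℝ) ∧
      ∀ i, (Fin.snoc s t : Fin (n + 1) → ℝ) i ∈ Set.Ioo u v) ↔
      t ∈ Set.Ioo u v ∧ StrictAnti s ∧ ∀ i, s i ∈ Set.Ioo t v := by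
  have h := snoc_strictMono_Ioo_iff (-s) (-t) (-v) (-u)
  have hs : (Fin.snoc (-s) (-t) : Fin (n + 1) → ℝ) = -(Fin.snoc s t : Fin (n + 1) → ℝ) := by
    ext i
    induction i using Fin.lastCases <;> simp
  have hneg : ∀ {m : ℕ} (r : Fin m → ℝ), StrictMono (-r) ↔ StrictAnti r := fun r ↦
    ⟨fun h i j hij ↦ neg_lt_neg_iff.mp (h hij), fun h i j hij ↦ neg_lt_neg (h hij)⟩
  have hIoo : ∀ r u v : ℝ, -r ∈ Set.Ioo (-v) (-u) ↔ r ∈ Set.Ioo u v := fun r u v ↦ by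
    simp [and_comm]
  rw [hs] at h
  simpa only [hneg, Pi.neg_apply, hIoo] using h

theorem simplexA_succ {f g : ℝ → ℂ} (hf : LocallyIntegrable f volume)
    (hg : LocallyIntegrable g volume) (n : ℕ) (x : ℝ) :
    simplexA f g (n + 1) x =
      ∫ t in (0:ℝ)..x, (if n % 2 = 0 then f t else g t) * simplexA f g n t := by
  by_cases hx : 0 ≤ x
  · rw [simplexA, if_pos hx, setIntegral_altProd_succ f g (measurableSet_strictMono _ _ _)
      measurableSet_Ioo (fun t ↦ measurableSet_strictMono n 0 t)
      (fun s t ↦ snoc_strictMono_Ioo_iff s t 0 x)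
      ((integrableOn_altProd_pi hf hg _ 0 x).mono_set fun s hs i _ ↦ hs.2 i),
      integral_of_le hx, integral_Ioc_eq_integral_Ioo]
    refine setIntegral_congr_fun measurableSet_Ioo fun t ht ↦ ?_
    simp only [simplexA, if_pos ht.1.le]
  · rw [simplexA, if_neg hx, setIntegral_altProd_succ f g (measurableSet_strictAnti _ _ _)
      measurableSet_Ioo (fun t ↦ measurableSet_strictAnti n t 0)
      (fun s t ↦ snoc_strictAnti_Ioo_iff s t x 0)
      ((integrableOn_altProd_pi hf hg _ x 0).mono_set fun s hs i _ ↦ hs.2 i),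
      integral_of_ge (not_le.mp hx).le, integral_Ioc_eq_integral_Ioo, pow_succ, mul_neg_one,
      neg_mul, ← MeasureTheory.integral_const_mul]
    congr 1
    refine setIntegral_congr_fun measurableSet_Ioo fun t ht ↦ ?_
    simp only [simplexA, if_neg (not_le.mpr ht.2)]
    ring

section Series

variable {u : ℕ → ℝ → ℂ}

theorem continuous_tsum_of_locally_bounded (hu : ∀ k, Continuous (u k))
    (hb : ∀ R, ∃ M : ℕ → ℝ, Summable M ∧ ∀ k, ∀ x ∈ Set.Icc (-R) R, ‖u k x‖ ≤ M k) :
    Continuous fun x ↦ ∑' k, u k x := by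
  refine continuous_iff_continuousAt.mpr fun x ↦ ?_
  obtain ⟨M, hM, h⟩ := hb (|x| + 1)
  refine (continuousOn_tsum (fun k ↦ (hu k).continuousOn) hM h).continuousAt
    (Icc_mem_nhds ?_ ?_)
  · linarith [neg_abs_le x]
  · linarith [le_abs_self x]

theorem hasSum_integral_mul_of_locally_bounded {φ : ℝ → ℂ} (hφ : LocallyIntegrable φ volume)
    (hu : ∀ k, Continuous (u k))
    (hb : ∀ R, ∃ M : ℕ → ℝ, Summable M ∧ ∀ k, ∀ x ∈ Set.Icc (-R) R, ‖u k x‖ ≤ M k) (x : ℝ) :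
    HasSum (fun k ↦ ∫ t in (0:ℝ)..x, φ t * u k t) (∫ t in (0:ℝ)..x, φ t * ∑' k, u k t) := by
  obtain ⟨M, hM, h⟩ := hb |x|
  have hmem : ∀ t ∈ Set.uIoc 0 x, t ∈ Set.Icc (-|x|) |x| := fun t ht ↦ by
    have := Set.abs_sub_left_of_mem_uIcc (Set.uIoc_subset_uIcc ht)
    simpa [abs_le] using this
  refine hasSum_integral_of_dominated_convergence (fun k t ↦ ‖φ t‖ * M k) (fun k ↦ ?_)
    (fun k ↦ .of_forall fun t ht ↦ ?_) (.of_forall fun t _ ↦ hM.mul_left _) ?_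
    (.of_forall fun t ht ↦ ?_)
  · exact ((hφ.mul_continuous (hu k)).intervalIntegrable_uIoc 0 x).def'.aestronglyMeasurable
  · rw [norm_mul]
    exact mul_le_mul_of_nonneg_left (h k t (hmem t ht)) (norm_nonneg _)
  · simp only [tsum_mul_left]
    exact (hφ.intervalIntegrable_uIoc 0 x).norm.mul_const _
  · exact (Summable.of_norm_bounded hM fun k ↦ h k t (hmem t ht)).hasSum.mul_left _

end Series

section BivariateExponential

variable {f g : ℝ → ℂ}

theorem continuous_simplexA (hf : LocallyIntegrable f volume) (hg : LocallyIntegrable g volume)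
    (n : ℕ) : Continuous (simplexA f g n) := by
  induction n with
  | zero => simpa only [funext (simplexA_zero f g)] using continuous_const
  | succ n ih =>
    rw [funext (simplexA_succ hf hg n)]
    refine continuous_primitive (LocallyIntegrable.intervalIntegrable_uIoc ?_) 0
    refine LocallyIntegrable.mul_continuous ih ?_
    split_ifs
    exacts [hf, hg]

theorem norm_simplexA_le (hf : LocallyIntegrable f volume) (hg : LocallyIntegrable g volume)
    (n : ℕ) (x : ℝ) :
    ‖simplexA f g n x‖ ≤ |∫ t in (0:ℝ)..x, (‖f t‖ + ‖g t‖)| ^ n / n.factorial := by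
  have hw : LocallyIntegrable (fun t ↦ ‖f t‖ + ‖g t‖) volume := fun t ↦
    (hf t).norm.add (hg t).norm
  set w : ℝ → ℝ := fun t ↦ ‖f t‖ + ‖g t‖
  have hw₀ : ∀ t, 0 ≤ w t := fun t ↦ add_nonneg (norm_nonneg _) (norm_nonneg _)
  set W : ℝ → ℝ := fun x ↦ ∫ t in (0:ℝ)..x, w t with hW
  have hWw : IsLocPrimitive W w := .integral hw
  change _ ≤ |W x| ^ n / _
  induction n generalizing x with
  | zero => simp [simplexA_zero]
  | succ n ih =>
    have hprim := hWw.pow n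
    obtain ⟨σ, hσ, hσW⟩ : ∃ σ : ℝ, |σ| = 1 ∧ ∀ t ∈ Set.uIoc 0 x, |W t| = σ * W t := by
      rcases le_total 0 x with hx | hx
      · refine ⟨1, by simp, fun t ht ↦ ?_⟩
        rw [Set.uIoc_of_le hx] at ht
        rw [one_mul, abs_of_nonneg (integral_nonneg ht.1.le fun s _ ↦ hw₀ s)]
      · refine ⟨-1, by simp, fun t ht ↦ ?_⟩
        rw [Set.uIoc_of_ge hx] at ht
        rw [neg_one_mul, abs_of_nonpos]
        simp only [hW]
        rw [integral_symm]
        exact neg_nonpos.mpr (integral_nonneg ht.2 fun s _ ↦ hw₀ s)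
    have hInt : ∫ t in (0:ℝ)..x, w t * W t ^ n = W x ^ (n + 1) / (n + 1) := by
      have h := hprim.2 x
      simp only [intervalIntegral.integral_const_mul] at h
      rw [h, show W 0 = 0 from integral_same, zero_pow n.succ_ne_zero, zero_add]
      field_simp
    rw [simplexA_succ hf hg]
    calc _ ≤ |∫ t in (0:ℝ)..x, σ ^ n / n.factorial * (w t * W t ^ n)| := by
          refine norm_integral_le_abs_of_norm_le ?_
            (((hw.mul_continuous (hWw.continuous.pow n)).intervalIntegrable_uIoc 0 x).const_mul _)
          refine (ae_restrict_iff' measurableSet_uIoc).mpr (.of_forall fun t ht ↦ ?_)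
          rw [norm_mul]
          calc _ ≤ w t * (|W t| ^ n / n.factorial) := by
                refine mul_le_mul ?_ (ih t) (norm_nonneg _) (hw₀ t)
                split_ifs
                · exact le_add_of_nonneg_right (norm_nonneg _)
                · exact le_add_of_nonneg_left (norm_nonneg _)
            _ = _ := by rw [hσW t ht]; ring
      _ = |W x| ^ (n + 1) / (n + 1).factorial := by
          rw [intervalIntegral.integral_const_mul, hInt, abs_mul, abs_div, abs_div, abs_pow,
            abs_pow, hσ, one_pow, Nat.factorial_succ, abs_of_nonneg (by positivity : (0:ℝ) ≤ n + 1),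
            Nat.abs_cast]
          push_cast
          field_simp

theorem simplexA_locally_bounded (hf : LocallyIntegrable f volume)
    (hg : LocallyIntegrable g volume) (R : ℝ) :
    ∃ M : ℕ → ℝ, Summable M ∧ ∀ k, ∀ x ∈ Set.Icc (-R) R, ‖simplexA f g k x‖ ≤ M k := by
  have hw : LocallyIntegrable (fun t ↦ ‖f t‖ + ‖g t‖) volume := fun t ↦
    (hf t).norm.add (hg t).norm
  obtain ⟨V, hV⟩ := isCompact_Icc.exists_bound_of_continuousOn (s := Set.Icc (-R) R)
    (IsLocPrimitive.integral hw).continuous.continuousOn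
  refine ⟨_, Real.summable_pow_div_factorial V, fun k x hx ↦ ?_⟩
  refine (norm_simplexA_le hf hg k x).trans ?_
  gcongr
  exact hV x hx

theorem simplexA_comp_locally_bounded (hf : LocallyIntegrable f volume)
    (hg : LocallyIntegrable g volume) {e : ℕ → ℕ} (he : e.Injective) (R : ℝ) :
    ∃ M : ℕ → ℝ, Summable M ∧ ∀ k, ∀ x ∈ Set.Icc (-R) R, ‖simplexA f g (e k) x‖ ≤ M k := by
  obtain ⟨M, hM, h⟩ := simplexA_locally_bounded hf hg R
  exact ⟨M ∘ e, hM.comp_injective he, fun k ↦ h (e k)⟩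

theorem summable_simplexA (hf : LocallyIntegrable f volume) (hg : LocallyIntegrable g volume)
    (x : ℝ) : Summable fun k ↦ simplexA f g k x := by
  obtain ⟨M, hM, h⟩ := simplexA_locally_bounded hf hg |x|
  exact .of_norm_bounded hM fun k ↦ h k x ⟨neg_abs_le x, le_abs_self x⟩

theorem injective_two_mul : Function.Injective fun k : ℕ ↦ 2 * k :=
  fun a b h ↦ by simpa using h

theorem injective_two_mul_add_one : Function.Injective fun k : ℕ ↦ 2 * k + 1 :=
  fun a b h ↦ by simpa using h

theorem bivE_eq_tsum (hf : LocallyIntegrable f volume) (hg : LocallyIntegrable g volume) (x : ℝ) :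
    bivE f g x = ∑' j, simplexA f g j x := by
  rw [bivE, (summable_simplexA hf hg x).tsum_eq_zero_add, simplexA_zero]

theorem bivE_eq_even_add_odd (hf : LocallyIntegrable f volume) (hg : LocallyIntegrable g volume)
    (x : ℝ) :
    bivE f g x = ∑' k, simplexA f g (2 * k) x + ∑' k, simplexA f g (2 * k + 1) x := by
  have hs := summable_simplexA hf hg x
  rw [bivE_eq_tsum hf hg]
  exact (tsum_even_add_odd (f := fun k ↦ simplexA f g k x)
    (hs.comp_injective injective_two_mul) (hs.comp_injective injective_two_mul_add_one)).symm

theorem bivE_neg_neg_eq_even_sub_odd (hf : LocallyIntegrable f volume)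
    (hg : LocallyIntegrable g volume) (x : ℝ) :
    bivE (-f) (-g) x = ∑' k, simplexA f g (2 * k) x - ∑' k, simplexA f g (2 * k + 1) x := by
  rw [bivE_eq_even_add_odd hf.neg hg.neg, sub_eq_add_neg, ← tsum_neg]
  simp [simplexA_neg_neg, pow_succ, pow_mul]

theorem bivC_eq_tsum (hf : LocallyIntegrable f volume) (hg : LocallyIntegrable g volume) :
    bivC f g = fun x ↦ ∑' k, simplexA f g (2 * k) x := by
  ext x
  rw [bivC, bivE_eq_even_add_odd hf hg, bivE_neg_neg_eq_even_sub_odd hf hg]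
  ring

theorem bivS_eq_tsum (hf : LocallyIntegrable f volume) (hg : LocallyIntegrable g volume) :
    bivS f g = fun x ↦ ∑' k, simplexA f g (2 * k + 1) x := by
  ext x
  rw [bivS, bivE_eq_even_add_odd hf hg, bivE_neg_neg_eq_even_sub_odd hf hg]
  ring

theorem continuous_bivC (hf : LocallyIntegrable f volume) (hg : LocallyIntegrable g volume) :
    Continuous (bivC f g) := by
  rw [bivC_eq_tsum hf hg]
  exact continuous_tsum_of_locally_bounded (fun k ↦ continuous_simplexA hf hg (2 * k))
    (simplexA_comp_locally_bounded hf hg injective_two_mul)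

theorem continuous_bivS (hf : LocallyIntegrable f volume) (hg : LocallyIntegrable g volume) :
    Continuous (bivS f g) := by
  rw [bivS_eq_tsum hf hg]
  exact continuous_tsum_of_locally_bounded (fun k ↦ continuous_simplexA hf hg (2 * k + 1))
    (simplexA_comp_locally_bounded hf hg injective_two_mul_add_one)

theorem bivC_eq_integral (hf : LocallyIntegrable f volume) (hg : LocallyIntegrable g volume)
    (x : ℝ) : bivC f g x = 1 + ∫ t in (0:ℝ)..x, g t * bivS f g t := by
  have h := hasSum_integral_mul_of_locally_bounded hg
    (fun k ↦ continuous_simplexA hf hg (2 * k + 1))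
    (simplexA_comp_locally_bounded hf hg injective_two_mul_add_one) x
  rw [bivC_eq_tsum hf hg, bivS_eq_tsum hf hg, ← h.tsum_eq]
  have hs : Summable fun k ↦ simplexA f g (2 * k) x :=
    (summable_simplexA hf hg x).comp_injective injective_two_mul
  simp only
  rw [hs.tsum_eq_zero_add, mul_zero, simplexA_zero]
  refine congrArg _ (tsum_congr fun k ↦ ?_)
  have hk : (2 * k + 1) % 2 ≠ 0 := by lia
  simp only [show 2 * (k + 1) = 2 * k + 1 + 1 by ring, simplexA_succ hf hg (2 * k + 1), if_neg hk]

theorem bivS_eq_integral (hf : LocallyIntegrable f volume) (hg : LocallyIntegrable g volume)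
    (x : ℝ) : bivS f g x = ∫ t in (0:ℝ)..x, f t * bivC f g t := by
  have h := hasSum_integral_mul_of_locally_bounded hf
    (fun k ↦ continuous_simplexA hf hg (2 * k))
    (simplexA_comp_locally_bounded hf hg injective_two_mul) x
  rw [bivC_eq_tsum hf hg, bivS_eq_tsum hf hg, ← h.tsum_eq]
  refine tsum_congr fun k ↦ ?_
  simp [simplexA_succ hf hg (2 * k)]

theorem bivC_apply_zero (hf : LocallyIntegrable f volume) (hg : LocallyIntegrable g volume) :
    bivC f g 0 = 1 := by
  simp [bivC_eq_integral hf hg]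

theorem bivS_apply_zero (hf : LocallyIntegrable f volume) (hg : LocallyIntegrable g volume) :
    bivS f g 0 = 0 := by
  simp [bivS_eq_integral hf hg]

theorem isLocPrimitive_bivC (hf : LocallyIntegrable f volume) (hg : LocallyIntegrable g volume) :
    IsLocPrimitive (bivC f g) (fun x ↦ g x * bivS f g x) :=
  ⟨hg.mul_continuous (continuous_bivS hf hg), fun x ↦ by
    rw [bivC_apply_zero hf hg, bivC_eq_integral hf hg]⟩

theorem isLocPrimitive_bivS (hf : LocallyIntegrable f volume) (hg : LocallyIntegrable g volume) :
    IsLocPrimitive (bivS f g) (fun x ↦ f x * bivC f g x) :=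
  ⟨hf.mul_continuous (continuous_bivC hf hg), fun x ↦ by
    rw [bivS_apply_zero hf hg, bivS_eq_integral hf hg x, zero_add]⟩

theorem bivC_mul_bivC_sub_bivS_mul_bivS (hf : LocallyIntegrable f volume)
    (hg : LocallyIntegrable g volume) (x : ℝ) :
    bivC f g x * bivC g f x - bivS g f x * bivS f g x = 1 := by
  have h₁ := ((isLocPrimitive_bivC hf hg).mul (isLocPrimitive_bivC hg hf)).2 x
  have h₂ := ((isLocPrimitive_bivS hg hf).mul (isLocPrimitive_bivS hf hg)).2 x
  simp only [bivC_apply_zero hf hg, bivC_apply_zero hg hf, bivS_apply_zero hf hg,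
    bivS_apply_zero hg hf] at h₁ h₂
  have h₃ : ∀ t, g t * bivS f g t * bivC g f t + bivC f g t * (f t * bivS g f t) =
      g t * bivC g f t * bivS f g t + bivS g f t * (f t * bivC f g t) := fun t ↦ by ring
  simp only [h₃] at h₁
  rw [h₁, h₂]
  ring

end BivariateExponential

theorem solution_matrix (f g h : ℝ → ℂ)
    (hf : LocallyIntegrable f volume) (hg : LocallyIntegrable g volume)
    (hh : LocallyIntegrable h volume)
    (Pg : ℝ → ℂ) (hPg : Pg = fun x => ∫ t in (0:ℝ)..x, g t)
    (F H : ℝ → ℂ)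
    (hF : F = fun x => -Complex.exp (Pg x) * f x)
    (hH : H = fun x => Complex.exp (-Pg x) * h x)
    (a b c d : ℝ → ℂ)
    (ha : a = fun x => Complex.exp (Pg x / 2) * bivC F H x)
    (hb : b = fun x => Complex.exp (Pg x / 2) * bivS H F x)
    (hc : c = fun x => Complex.exp (-(Pg x) / 2) * bivS F H x)
    (hd : d = fun x => Complex.exp (-(Pg x) / 2) * bivC H F x) :
    (LocAC a ∧ LocAC b ∧ LocAC c ∧ LocAC d) ∧
    (a 0 = 1 ∧ b 0 = 0 ∧ c 0 = 0 ∧ d 0 = 1) ∧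
    (∀ x : ℝ, a x * d x - b x * c x = 1) ∧
    (∀ᵐ x : ℝ,
      HasDerivAt a (g x / 2 * a x + h x * c x) x ∧
      HasDerivAt b (g x / 2 * b x + h x * d x) x ∧
      HasDerivAt c (-f x * a x + -(g x / 2) * c x) x ∧
      HasDerivAt d (-f x * b x + -(g x / 2) * d x) x) := by
  have hP : IsLocPrimitive Pg g := hPg ▸ .integral hg
  have hP₀ : Pg 0 = 0 := by simp [hPg]
  have hFx : ∀ x, F x = -Complex.exp (Pg x) * f x := congrFun hF
  have hHx : ∀ x, H x = Complex.exp (-Pg x) * h x := congrFun hH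
  have hFi : LocallyIntegrable F volume := by
    have h := hf.mul_continuous (Complex.continuous_exp.comp hP.continuous).neg
    rw [hF]
    simpa only [mul_comm, Function.comp, Pi.neg_apply] using h
  have hHi : LocallyIntegrable H volume := by
    have h := hh.mul_continuous (Complex.continuous_exp.comp hP.continuous.neg)
    rw [hH]
    simpa only [mul_comm, Function.comp, Pi.neg_apply] using h
  have hpos : IsLocPrimitive (fun x ↦ Complex.exp (Pg x / 2))
      (fun x ↦ g x / 2 * Complex.exp (Pg x / 2)) := by
    simpa only [div_eq_inv_mul] using (hP.const_mul (2⁻¹ : ℂ)).cexp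
  have hneg : IsLocPrimitive (fun x ↦ Complex.exp (-(Pg x) / 2))
      (fun x ↦ -(g x / 2) * Complex.exp (-(Pg x) / 2)) := by
    convert! (hP.const_mul (-2⁻¹ : ℂ)).cexp using 3 with x <;> ring_nf
  have hexp₁ : ∀ x, Complex.exp (Pg x / 2) * Complex.exp (-Pg x) =
      Complex.exp (-(Pg x) / 2) := fun x ↦ by
    rw [← Complex.exp_add]; ring_nf
  have hexp₂ : ∀ x, Complex.exp (-(Pg x) / 2) * Complex.exp (Pg x) =
      Complex.exp (Pg x / 2) := fun x ↦ by
    rw [← Complex.exp_add]; ring_nf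
  have hexp₃ : ∀ x, Complex.exp (Pg x / 2) * Complex.exp (-(Pg x) / 2) = 1 := fun x ↦ by
    rw [← Complex.exp_add, ← Complex.exp_zero]; ring_nf
  have ha' : IsLocPrimitive a (fun x ↦ g x / 2 * a x + h x * c x) := by
    convert! hpos.mul (isLocPrimitive_bivC hFi hHi) using 2
    simp only [ha, hc, ← hexp₁, hHx]
    ring
  have hb' : IsLocPrimitive b (fun x ↦ g x / 2 * b x + h x * d x) := by
    convert! hpos.mul (isLocPrimitive_bivS hHi hFi) using 2
    simp only [hb, hd, ← hexp₁, hHx]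
    ring
  have hc' : IsLocPrimitive c (fun x ↦ -f x * a x + -(g x / 2) * c x) := by
    convert! hneg.mul (isLocPrimitive_bivS hFi hHi) using 2
    simp only [ha, hc, ← hexp₂, hFx]
    ring
  have hd' : IsLocPrimitive d (fun x ↦ -f x * b x + -(g x / 2) * d x) := by
    convert! hneg.mul (isLocPrimitive_bivC hHi hFi) using 2
    simp only [hb, hd, ← hexp₂, hFx]
    ring
  refine ⟨⟨⟨_, ha'⟩, ⟨_, hb'⟩, ⟨_, hc'⟩, ⟨_, hd'⟩⟩, ?_, fun x ↦ ?_, ?_⟩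
  · simp [ha, hb, hc, hd, hP₀, bivC_apply_zero, bivS_apply_zero, hFi, hHi]
  · have hdet := bivC_mul_bivC_sub_bivS_mul_bivS hFi hHi x
    simp only [ha, hb, hc, hd]
    linear_combination Complex.exp (Pg x / 2) * Complex.exp (-(Pg x) / 2) * hdet + hexp₃ x
  · filter_upwards [ha'.ae_hasDerivAt, hb'.ae_hasDerivAt, hc'.ae_hasDerivAt, hd'.ae_hasDerivAt]
      with x h₁ h₂ h₃ h₄ using ⟨h₁, h₂, h₃, h₄⟩
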